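/- Let N : (1, ∞) → ℕ satisfy N(γ)/ln γ → 2/ln 5 as γ → ∞, and let s : (1, ∞) → ℝ satisfy 0 < s(γ) ≤ s_m and s(γ) → 1/4 as γ → ∞. Define the total extremal duration τ(γ) = τᵢ⁺(s(γ), γ) + N(γ)·(τ_{u₁}(s(γ), γ) + τ_{u₂}(s(γ), γ)) + τ_f(s(γ), γ). Then τ(γ)/ln γ → (2/ln 5)·[2 + (π + arccos(3/5))/2] as γ → ∞. Equivalently, writing T_c/T_h = 1/γ² and τ₀ = [2 + (π + arccos(3/5))/2]/ln 5 ≈ 2.5, the cooling time satisfies τ ∼ τ₀ ln(T_h/T_c), so the achievable temperature decreases exponentially with the available time. -/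

import Mathlib

open Filter

/-- `u₁ = 1/γ⁴`. -/
noncomputable def u1 (γ : ℝ) : ℝ := 1 / γ ^ 4

/-- `u₂ = 1`. -/
noncomputable def u2 : ℝ := 1

/-- `c₁ = u₁ + 1`. -/
noncomputable def c1 (γ : ℝ) : ℝ := u1 γ + 1

/-- `c = γ² + 1/γ²`. -/
noncomputable def cConst (γ : ℝ) : ℝ := γ ^ 2 + 1 / γ ^ 2

/-- `s_m = (1 - u₁)²/4`. -/
noncomputable def sm (γ : ℝ) : ℝ := (1 - u1 γ) ^ 2 / 4

/-- Duration `τᵢ⁺(s, γ)` of the initial segment. -/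
noncomputable def tauIPlus (s γ : ℝ) : ℝ :=
  1 / (2 * Real.sqrt (u1 γ)) *
    Real.arccos
      ((s * c1 γ - u1 γ * Real.sqrt ((c1 γ) ^ 2 - 4 * (s + u1 γ))) /
        ((s + u1 γ) * Real.sqrt ((c1 γ) ^ 2 - 4 * u1 γ)))

/-- Duration `τ_f(s, γ)` of the final segment. -/
noncomputable def tauF (s γ : ℝ) : ℝ :=
  1 / (2 * Real.sqrt u2) *
    Real.arccos
      ((-(s * cConst γ) + u2 * Real.sqrt ((cConst γ) ^ 2 - 4 * (s + u2))) /
        ((s + u2) * Real.sqrt ((cConst γ) ^ 2 - 4 * u2)))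

/-- Duration `τ_{u₁}(s, γ)` of each intermediate segment with control `u₁`. -/
noncomputable def tauU1 (s γ : ℝ) : ℝ :=
  1 / (2 * Real.sqrt (u1 γ)) * Real.arccos ((s - u1 γ) / (s + u1 γ))

/-- Duration `τ_{u₂}(s, γ)` of each intermediate segment with control `u₂`. -/
noncomputable def tauU2 (s γ : ℝ) : ℝ :=
  1 / (2 * Real.sqrt u2) * (2 * Real.pi - Real.arccos ((s - u2) / (s + u2)))

/-- Total duration of the extremal with `2N(γ)+1` switchings. -/
noncomputable def tauTotal (N : ℝ → ℕ) (s : ℝ → ℝ) (γ : ℝ) : ℝ :=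
  tauIPlus (s γ) γ + (N γ : ℝ) * (tauU1 (s γ) γ + tauU2 (s γ) γ) + tauF (s γ) γ

open Topology

lemma arccos_sq_le_of_one_sub_le {x δ : ℝ} (hδ : 0 ≤ δ) (hx : 1 - x ≤ δ) :
    Real.arccos x ^ 2 ≤ Real.pi ^ 2 / 2 * δ := by
  have hpi := Real.pi_pos
  rcases le_total 1 x with h | h
  · rw [Real.arccos_of_one_le h, zero_pow two_ne_zero]
    positivity
  · have hcos : x ≤ Real.cos (Real.arccos x) := by
      rcases le_total x (-1) with h' | h'
      · rw [Real.arccos_of_le_neg_one h', Real.cos_pi]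
        exact h'
      · rw [Real.cos_arccos h' h]
    have hquad := Real.cos_le_one_sub_mul_cos_sq
      (abs_le.2 ⟨by linarith [Real.arccos_nonneg x], Real.arccos_le_pi x⟩)
    have hmul : 2 / Real.pi ^ 2 * Real.arccos x ^ 2 ≤ δ := by linarith
    calc Real.arccos x ^ 2
        = Real.pi ^ 2 / 2 * (2 / Real.pi ^ 2 * Real.arccos x ^ 2) := by field_simp
      _ ≤ Real.pi ^ 2 / 2 * δ := by gcongr

lemma arccos_one_sub_sq_div_one_add_sq {t : ℝ} (ht : 0 ≤ t) :
    Real.arccos ((1 - t ^ 2) / (1 + t ^ 2)) = 2 * Real.arctan t := by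
  have hcos : Real.cos (2 * Real.arctan t) = (1 - t ^ 2) / (1 + t ^ 2) := by
    rw [Real.cos_two_mul, Real.cos_sq_arctan]
    field_simp
    ring
  rw [← hcos, Real.arccos_cos]
  · have := Real.arctan_nonneg.2 ht
    positivity
  · linarith [Real.arctan_lt_pi_div_two t]

lemma sqrt_u1 (γ : ℝ) : Real.sqrt (u1 γ) = 1 / γ ^ 2 := by
  have h : u1 γ = (1 / γ ^ 2) ^ 2 := by
    rw [u1, div_pow, one_pow, ← pow_mul]
  rw [h, Real.sqrt_sq (by positivity)]

lemma u1_pos {γ : ℝ} (hγ : 0 < γ) : 0 < u1 γ := by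
  unfold u1
  positivity

lemma tendsto_sqrt_u1 : Tendsto (fun γ => Real.sqrt (u1 γ)) atTop (𝓝 0) := by
  simp_rw [sqrt_u1, one_div]
  exact (tendsto_pow_atTop two_ne_zero).inv_tendsto_atTop

lemma tauU1_eq {s γ : ℝ} (hs : 0 < s) (hγ : 0 < γ) :
    tauU1 s γ = (√(u1 γ) / √s)⁻¹ * Real.arctan (√(u1 γ) / √s) * (√s)⁻¹ := by
  have hu := u1_pos hγ
  have harg : (s - u1 γ) / (s + u1 γ) =
      (1 - (√(u1 γ) / √s) ^ 2) / (1 + (√(u1 γ) / √s) ^ 2) := by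
    rw [div_pow, Real.sq_sqrt hu.le, Real.sq_sqrt hs.le]
    field_simp
  have := Real.sqrt_pos.2 hu
  have := Real.sqrt_pos.2 hs
  rw [tauU1, harg, arccos_one_sub_sq_div_one_add_sq (by positivity)]
  field_simp

lemma tendsto_inv_mul_arctan :
    Tendsto (fun t => t⁻¹ * Real.arctan t) (𝓝[≠] 0) (𝓝 1) := by
  simpa using (Real.hasDerivAt_arctan 0).tendsto_slope_zero

lemma tendsto_tauU1 {s : ℝ → ℝ} {a : ℝ} (ha : 0 < a) (hlim : Tendsto s atTop (𝓝 a)) :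
    Tendsto (fun γ => tauU1 (s γ) γ) atTop (𝓝 (√a)⁻¹) := by
  have hsqrt : Tendsto (fun γ => √(s γ)) atTop (𝓝 √a) := hlim.sqrt
  have hne : √a ≠ 0 := (Real.sqrt_pos.2 ha).ne'
  have hs : ∀ᶠ γ in atTop, 0 < s γ := hlim.eventually_const_lt ha
  have hquot : Tendsto (fun γ => √(u1 γ) / √(s γ)) atTop (𝓝[≠] 0) := by
    have hzero := tendsto_sqrt_u1.div hsqrt hne
    rw [zero_div] at hzero
    refine tendsto_nhdsWithin_iff.2 ⟨hzero, ?_⟩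
    filter_upwards [hs, eventually_gt_atTop 0] with γ hsγ hγ
    exact (div_pos (Real.sqrt_pos.2 (u1_pos hγ)) (Real.sqrt_pos.2 hsγ)).ne'
  have hprod := (tendsto_inv_mul_arctan.comp hquot).mul (hsqrt.inv₀ hne)
  rw [one_mul] at hprod
  refine hprod.congr' ?_
  filter_upwards [hs, eventually_gt_atTop 0] with γ hsγ hγ
  exact (tauU1_eq hsγ hγ).symm

lemma tendsto_tauU2 {s : ℝ → ℝ} (hlim : Tendsto s atTop (𝓝 (1 / 4))) :
    Tendsto (fun γ => tauU2 (s γ) γ) atTop (𝓝 ((Real.pi + Real.arccos (3 / 5)) / 2)) := by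
  have hquot : Tendsto (fun γ => (s γ - 1) / (s γ + 1)) atTop (𝓝 (-(3 / 5))) := by
    rw [show (-(3 / 5) : ℝ) = (1 / 4 - 1) / (1 / 4 + 1) by norm_num]
    exact (hlim.sub_const 1).div (hlim.add_const 1) (by norm_num)
  have h := ((Real.continuous_arccos.tendsto _).comp hquot).const_sub (2 * Real.pi)
  have h' := h.const_mul (1 / 2)
  rw [Real.arccos_neg] at h'
  simp only [tauU2, u2, Real.sqrt_one, mul_one]
  rw [show (Real.pi + Real.arccos (3 / 5)) / 2 =
    1 / 2 * (2 * Real.pi - (Real.pi - Real.arccos (3 / 5))) by ring]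
  exact h'

lemma abs_tauF_le (s γ : ℝ) : |tauF s γ| ≤ Real.pi / 2 := by
  simp only [tauF, u2, Real.sqrt_one, mul_one]
  rw [abs_of_nonneg (mul_nonneg (by norm_num) (Real.arccos_nonneg _))]
  linarith [Real.arccos_le_pi ((-(s * cConst γ) + 1 * √(cConst γ ^ 2 - 4 * (s + 1))) /
    ((s + 1) * √(cConst γ ^ 2 - 4)))]

lemma abs_tauIPlus_le {s γ : ℝ} (hγ : 0 < γ) (hu : u1 γ ≤ 1 / 2) (hs : 1 / 8 ≤ s) :
    |tauIPlus s γ| ≤ 2 * Real.pi := by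
  have hupos := u1_pos hγ
  have hpi := Real.pi_pos
  have hc : √(c1 γ ^ 2 - 4 * u1 γ) = 1 - u1 γ := by
    rw [show c1 γ ^ 2 - 4 * u1 γ = (1 - u1 γ) ^ 2 by unfold c1; ring,
      Real.sqrt_sq (by linarith)]
  have hr : √(c1 γ ^ 2 - 4 * (s + u1 γ)) ≤ 1 := by
    rw [Real.sqrt_le_one]
    unfold c1
    nlinarith
  have hden : 1 / 16 ≤ (s + u1 γ) * (1 - u1 γ) := by nlinarith
  have harg : 1 - (s * c1 γ - u1 γ * √(c1 γ ^ 2 - 4 * (s + u1 γ))) /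
      ((s + u1 γ) * √(c1 γ ^ 2 - 4 * u1 γ)) ≤ 32 * u1 γ := by
    rw [hc, one_sub_div (by linarith), div_le_iff₀ (by linarith)]
    have hmul := mul_le_mul_of_nonneg_left hr hupos.le
    have hmul' := mul_le_mul_of_nonneg_left hden hupos.le
    have hsu : 0 ≤ s * u1 γ := by positivity
    unfold c1 at *
    nlinarith [sq_nonneg (u1 γ)]
  have hsq := arccos_sq_le_of_one_sub_le (by positivity) harg
  refine abs_le_of_sq_le_sq ?_ (by positivity)
  rw [tauIPlus, mul_pow, div_pow, mul_pow, Real.sq_sqrt hupos.le, one_pow, one_div,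
    inv_mul_le_iff₀ (by positivity)]
  linarith

lemma tendsto_div_log_of_abs_le {f : ℝ → ℝ} {C : ℝ} (hf : ∀ᶠ γ in atTop, |f γ| ≤ C) :
    Tendsto (fun γ => f γ / Real.log γ) atTop (𝓝 0) := by
  simp_rw [div_eq_inv_mul]
  exact Real.tendsto_log_atTop.inv_tendsto_atTop.zero_mul_isBoundedUnder_le
    (isBoundedUnder_of_eventually_le (by simpa using hf))

/-- If `N(γ)/ln γ → 2/ln 5` and the switching ratio satisfies `0 < s(γ) ≤ s_m`
with `s(γ) → 1/4`, then the total extremal duration satisfies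
`τ(γ)/ln γ → (2/ln 5)·(2 + (π + arccos(3/5))/2)` as `γ → ∞`: the cooling time
grows only logarithmically in `γ² = T_h/T_c`, i.e. the achievable temperature
decreases exponentially with the available time. -/
theorem cooling_time_logarithmic (N : ℝ → ℕ) (s : ℝ → ℝ)
    (hN : Tendsto (fun γ : ℝ => (N γ : ℝ) / Real.log γ) atTop
      (nhds (2 / Real.log 5)))
    (hs : ∀ γ : ℝ, 1 < γ → 0 < s γ ∧ s γ ≤ sm γ)
    (hlim : Tendsto s atTop (nhds (1 / 4))) :
    Tendsto (fun γ : ℝ => tauTotal N s γ / Real.log γ) atTop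
      (nhds (2 / Real.log 5 * (2 + (Real.pi + Real.arccos (3 / 5)) / 2))) := by
  have hu : ∀ᶠ γ in atTop, u1 γ ≤ 1 / 2 := by
    have h : Tendsto (fun γ => u1 γ) atTop (𝓝 0) := by
      simp_rw [u1, one_div]
      exact (tendsto_pow_atTop four_ne_zero).inv_tendsto_atTop
    exact h.eventually_le_const (by norm_num)
  have hI : Tendsto (fun γ => tauIPlus (s γ) γ / Real.log γ) atTop (𝓝 0) := by
    refine tendsto_div_log_of_abs_le (C := 2 * Real.pi) ?_
    filter_upwards [hu, eventually_gt_atTop 0,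
      hlim.eventually_const_le (show (1 / 8 : ℝ) < 1 / 4 by norm_num)] with γ huγ hγ hsγ
    exact abs_tauIPlus_le hγ huγ hsγ
  have hF : Tendsto (fun γ => tauF (s γ) γ / Real.log γ) atTop (𝓝 0) :=
    tendsto_div_log_of_abs_le (Eventually.of_forall fun γ => abs_tauF_le (s γ) γ)
  have hquarter : (√(1 / 4 : ℝ))⁻¹ = 2 := by
    rw [show (1 / 4 : ℝ) = (1 / 2) ^ 2 by norm_num, Real.sqrt_sq (by norm_num)]
    norm_num
  have hU1 := tendsto_tauU1 (by norm_num) hlim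
  rw [hquarter] at hU1
  have h := (hI.add (hN.mul (hU1.add (tendsto_tauU2 hlim)))).add hF
  rw [zero_add, add_zero] at h
  refine h.congr fun γ => ?_
  rw [tauTotal]
  ring
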